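/- arXiv:1807.10650 — 3 statements merged into one kernel-verified Lean document; each statement's English description precedes it below -/
import Mathlib

section
/- Let n ∈ ℕ. Every pair q = (q₁, q₂) of real polynomials in two variables of total degree at most n admits a decomposition q = ∇p + x⊥·r with p a polynomial of total degree at most n+1 and r a polynomial of total degree at most n−1; moreover the decomposition is unique in the sense that if ∇p + x⊥·r = ∇p' + x⊥·r' with p, p' of degree at most n+1 and r, r' of degree at most n−1, then r = r' and p − p' is a constant. In other words, [P_n]² = ∇(P_{n+1}) ⊕ x⊥ P_{n−1}. -/
open MvPolynomial

lemma aux_coeff (i : Fin 2) (p : MvPolynomial (Fin 2) ℝ) (v : Fin 2 →₀ ℕ) :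
    coeff v (X i * pderiv i p) = (v i : ℝ) * coeff v p := by
  induction p using MvPolynomial.induction_on' with
  | monomial u a =>
    rw [X_mul_pderiv_monomial, coeff_smul, coeff_monomial]
    split_ifs with h
    · subst h; simp
    · simp
  | add p q hp hq => rw [map_add, mul_add, coeff_add, hp, hq, coeff_add, mul_add]

lemma aux_add {n : ℕ} {r s : MvPolynomial (Fin 2) ℝ} (hr : r = 0 ∨ r.totalDegree + 1 ≤ n)
    (hs : s = 0 ∨ s.totalDegree + 1 ≤ n) : r + s = 0 ∨ (r + s).totalDegree + 1 ≤ n := by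
  rcases hr with rfl | hr
  · simpa using hs
  · rcases hs with rfl | hs
    · right; simpa using hr
    · right
      have := totalDegree_add r s
      have := max_le (show r.totalDegree ≤ n - 1 by omega) (show s.totalDegree ≤ n - 1 by omega)
      omega

lemma aux_monomial (n : ℕ) (i j : Fin 2) (hij : i ≠ j) (v : Fin 2 →₀ ℕ) (c : ℝ)
    (hv : v i + v j ≤ n) :
    ∃ p r : MvPolynomial (Fin 2) ℝ,
        p.totalDegree ≤ n + 1 ∧ (r = 0 ∨ r.totalDegree + 1 ≤ n) ∧
        monomial v c = pderiv i p + X j * r ∧ pderiv j p = X i * r := by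
  have hdeg : ∀ w : Fin 2 →₀ ℕ, (w.sum fun _ => id) = w i + w j := by
    intro w
    rw [Finsupp.sum_fintype _ _ (by simp), Fin.sum_univ_two]
    fin_cases i <;> fin_cases j <;> simp_all [add_comm]
  have hD : ((v i : ℝ) + v j + 1) ≠ 0 := by positivity
  have hp : pderiv i (monomial (v + Finsupp.single i 1) (c / ((v i : ℝ) + v j + 1)))
      = monomial v (c / ((v i : ℝ) + v j + 1) * (v i + 1)) := by
    rw [pderiv_monomial]; simp
  obtain ⟨D, hDdef⟩ : ∃ D : ℝ, D = (v i : ℝ) + v j + 1 := ⟨_, rfl⟩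
  rw [← hDdef] at hD hp
  by_cases hj : v j = 0
  · refine ⟨monomial (v + Finsupp.single i 1) (c / D), 0, ?_, Or.inl rfl, ?_, ?_⟩
    · refine (totalDegree_monomial_le _ _).trans ?_
      rw [hdeg]; simp [hij]; omega
    · rw [hp, mul_zero, add_zero]; congr 1; rw [hj] at hDdef; field_simp; rw [hDdef]; simp
    · rw [pderiv_monomial]; simp [hj, hij]
  · obtain ⟨w, rfl⟩ : ∃ w : Fin 2 →₀ ℕ, v = w + Finsupp.single j 1 :=
      ⟨v - Finsupp.single j 1, (tsub_add_cancel_of_le (by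
        rw [Finsupp.single_le_iff]; omega)).symm⟩
    refine ⟨monomial (w + Finsupp.single j 1 + Finsupp.single i 1) (c / D),
      monomial w (c / D * (w j + 1)), ?_, Or.inr ?_, ?_, ?_⟩
    · refine (totalDegree_monomial_le _ _).trans ?_
      rw [hdeg]; simp [hij, hij.symm] at hv ⊢; omega
    · have := totalDegree_monomial_le w (c / D * (w j + 1))
      rw [hdeg] at this; simp [hij, hij.symm] at hv; omega
    · rw [hp, X, monomial_mul, add_comm (Finsupp.single j 1) w, ← map_add]
      congr 1
      field_simp
      rw [hDdef]; simp [hij]; left; ring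
    · rw [pderiv_monomial, X, monomial_mul, add_right_comm, add_tsub_cancel_right, add_comm w]
      simp [hij, hij.symm]

lemma aux_exists (n : ℕ) (i j : Fin 2) (hij : i ≠ j) (q : MvPolynomial (Fin 2) ℝ)
    (hq : q.totalDegree ≤ n) :
    ∃ p r : MvPolynomial (Fin 2) ℝ,
        p.totalDegree ≤ n + 1 ∧ (r = 0 ∨ r.totalDegree + 1 ≤ n) ∧
        q = pderiv i p + X j * r ∧ pderiv j p = X i * r := by
  have key : ∀ s : Finset (Fin 2 →₀ ℕ), s ⊆ q.support → ∃ p r : MvPolynomial (Fin 2) ℝ,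
        p.totalDegree ≤ n + 1 ∧ (r = 0 ∨ r.totalDegree + 1 ≤ n) ∧
        ∑ v ∈ s, monomial v (coeff v q) = pderiv i p + X j * r ∧ pderiv j p = X i * r := by
    intro s
    induction s using Finset.induction_on with
    | empty => intro _; exact ⟨0, 0, by simp, Or.inl rfl, by simp, by simp⟩
    | insert v s hvs ih =>
      intro hs
      obtain ⟨p, r, h1, h2, h3, h4⟩ := ih ((Finset.subset_insert _ _).trans hs)
      have hv := (le_totalDegree (hs (Finset.mem_insert_self v s))).trans hq
      rw [Finsupp.sum_fintype _ _ (by simp), Fin.sum_univ_two] at hv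
      have hv' : v i + v j ≤ n := by
        fin_cases i <;> fin_cases j <;> simp_all [add_comm]
      obtain ⟨p', r', k1, k2, k3, k4⟩ := aux_monomial n i j hij v (coeff v q) hv'
      refine ⟨p' + p, r' + r, (totalDegree_add _ _).trans (max_le k1 h1), aux_add k2 h2, ?_, ?_⟩
      · rw [Finset.sum_insert hvs, h3, k3, map_add]; ring
      · rw [map_add, k4, h4]; ring
  obtain ⟨p, r, h1, h2, h3, h4⟩ := key _ subset_rfl
  exact ⟨p, r, h1, h2, by rw [← h3]; exact q.as_sum, h4⟩



/-- `[P_n]² = ∇(P_{n+1}) ⊕ x⊥ P_{n−1}` : every pair `q = (q₁, q₂)` of real polynomials in two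
variables of total degree at most `n` can be written as `q = ∇p + x⊥ r` with
`deg p ≤ n+1` and `r ∈ P_{n-1}` (i.e. `r = 0` or `deg r ≤ n-1`, with the convention
`P_{-1} = {0}`), and the decomposition is unique up to an additive constant in `p`.
Here `x⊥ = (x₂, −x₁)`, so `x⊥ r = (x₂ r, −x₁ r)`, and `∇p = (∂p/∂x₁, ∂p/∂x₂)`. -/
theorem statement0 (n : ℕ) (q₁ q₂ : MvPolynomial (Fin 2) ℝ)
    (hq₁ : q₁.totalDegree ≤ n) (hq₂ : q₂.totalDegree ≤ n) :
    (∃ p r : MvPolynomial (Fin 2) ℝ,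
        p.totalDegree ≤ n + 1 ∧ (r = 0 ∨ r.totalDegree + 1 ≤ n) ∧
        q₁ = pderiv 0 p + X 1 * r ∧
        q₂ = pderiv 1 p - X 0 * r) ∧
    (∀ p p' r r' : MvPolynomial (Fin 2) ℝ,
        p.totalDegree ≤ n + 1 → p'.totalDegree ≤ n + 1 →
        (r = 0 ∨ r.totalDegree + 1 ≤ n) → (r' = 0 ∨ r'.totalDegree + 1 ≤ n) →
        pderiv 0 p + X 1 * r = pderiv 0 p' + X 1 * r' →
        pderiv 1 p - X 0 * r = pderiv 1 p' - X 0 * r' →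
        r = r' ∧ ∃ c : ℝ, p - p' = C c) := by
  constructor
  · obtain ⟨p, r, h1, h2, h3, h4⟩ := aux_exists n 0 1 (by decide) q₁ hq₁
    obtain ⟨p', r', k1, k2, k3, k4⟩ := aux_exists n 1 0 (by decide) q₂ hq₂
    refine ⟨p + p', r + -r', (totalDegree_add _ _).trans (max_le h1 k1),
      aux_add h2 (by simpa using k2), ?_, ?_⟩
    · rw [map_add, k4, h3]; ring
    · rw [map_add, h4, k3]; ring
  · intro p p' r r' _ _ _ _ h1 h2
    have e : X 0 * pderiv 0 (p - p') + X 1 * pderiv 1 (p - p') = 0 := by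
      rw [map_sub, map_sub]
      linear_combination X 0 * h1 + X 1 * h2
    have hc : p - p' = C (coeff 0 (p - p')) := by
      ext v
      rw [coeff_C]
      split_ifs with hv
      · rw [hv]
      · have := congrArg (coeff v) e
        rw [coeff_add, aux_coeff, aux_coeff, coeff_zero, ← add_mul] at this
        rcases mul_eq_zero.1 this with h | h
        · exfalso
          apply hv
          have h' : v 0 + v 1 = 0 := by exact_mod_cast h
          ext i
          fin_cases i <;> simp <;> omega
        · exact h
    refine ⟨?_, _, hc⟩
    have hd : pderiv 0 (p - p') = 0 := by rw [hc, pderiv_C]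
    rw [map_sub] at hd
    have : (X 1 : MvPolynomial (Fin 2) ℝ) * (r - r') = 0 := by
      linear_combination h1 - hd
    rcases mul_eq_zero.1 this with h | h
    · exact absurd h (X_ne_zero _)
    · exact sub_eq_zero.1 h
end

section
/- Let m ∈ ℕ. The curl operator is an isomorphism from x⊥ P_m onto P_m: for every real polynomial q in two variables of total degree at most m there exists a unique polynomial p of total degree at most m such that q = curl(x⊥ p), where curl(x⊥ p) = ∂(−x₁ p)/∂x₁ − ∂(x₂ p)/∂x₂. -/
open MvPolynomial

lemma curl_coeff (p : MvPolynomial (Fin 2) ℝ) (d : Fin 2 →₀ ℕ) :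
    coeff d (pderiv 0 (-(X 0 * p)) - pderiv 1 (X 1 * p)) = -(2 + (d 0 : ℝ) + d 1) * coeff d p := by
  induction p using MvPolynomial.induction_on' with
  | monomial e a =>
    have h : ∀ i : Fin 2, pderiv i (X i * monomial e a : MvPolynomial (Fin 2) ℝ)
        = monomial e (a * (e i + 1)) := by
      intro i
      rw [X, monomial_mul, pderiv_monomial]
      simp [add_comm]
    rw [map_neg, h, h, coeff_sub, coeff_neg]
    simp only [coeff_monomial]
    split_ifs with hd
    · subst hd; ring
    · simp
  | add p r hp hr =>
    rw [coeff_add, mul_add (-(2 + (d 0 : ℝ) + d 1)), ← hp, ← hr, ← coeff_add]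
    congr 1
    simp only [mul_add, map_add, map_neg]
    ring


/-- The `curl` operator is an isomorphism from `x⊥ P_m` onto `P_m`: for every real polynomial
`q` in two variables of total degree at most `m` there is a unique polynomial `p` of total
degree at most `m` such that `q = curl (x⊥ p) = ∂(−x₁ p)/∂x₁ − ∂(x₂ p)/∂x₂`,
where `x⊥ = (x₂, −x₁)`. -/
theorem statement1 (m : ℕ) (q : MvPolynomial (Fin 2) ℝ) (hq : q.totalDegree ≤ m) :
    ∃! p : MvPolynomial (Fin 2) ℝ, p.totalDegree ≤ m ∧
      q = pderiv 0 (-(X 0 * p)) - pderiv 1 (X 1 * p) := by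
  have hne : ∀ d : Fin 2 →₀ ℕ, (-(2 + (d 0 : ℝ) + d 1)) ≠ 0 := by
    intro d
    have : 0 < 2 + (d 0 : ℝ) + d 1 := by positivity
    exact neg_ne_zero.mpr this.ne'
  let p : MvPolynomial (Fin 2) ℝ :=
    ∑ d ∈ q.support, monomial d (coeff d q / (-(2 + (d 0 : ℝ) + d 1)))
  have hp : ∀ d, coeff d p = coeff d q / (-(2 + (d 0 : ℝ) + d 1)) := by
    intro d
    simp only [p, coeff_sum, coeff_monomial, Finset.sum_ite_eq']
    split_ifs with h
    · rfl
    · rw [notMem_support_iff.mp h, zero_div]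
  refine ⟨p, ⟨?_, ?_⟩, ?_⟩
  · refine le_trans (totalDegree_le_of_support_subset ?_) hq
    intro d hd
    rw [mem_support_iff] at hd ⊢
    intro h
    exact hd (by rw [hp, h, zero_div])
  · ext d
    rw [curl_coeff, hp, mul_div_cancel₀ _ (hne d)]
  · rintro r ⟨-, hr⟩
    ext d
    rw [hp, hr, curl_coeff, mul_div_cancel_left₀ _ (hne d)]
end

section
/- Let V be a real Hilbert space, let a : V × V → ℝ be a continuous bilinear form with coercivity constant α > 0 (i.e. a(v,v) ≥ α‖v‖² for all v ∈ V), let c : V × V × V → ℝ be a trilinear form satisfying |c(w,u,v)| ≤ Ĉ‖w‖‖u‖‖v‖ for all w, u, v ∈ V and c(w,v,v) = 0 for all w, v ∈ V, let f : V → ℝ be a continuous linear functional with dual norm ‖f‖, and let ν > 0. If γ := Ĉ‖f‖/(α²ν²) < 1, then there exists a unique u ∈ V such that ν a(u,v) + c(u; u, v) = f(v) for all v ∈ V, and this solution satisfies ‖u‖ ≤ ‖f‖/(α ν). -/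
/-- Abstract small-data well-posedness for a Navier–Stokes-type variational problem in a
real Hilbert space `V`: given a continuous bilinear form `a` which is coercive with constant
`α > 0`, a trilinear form `c` bounded with constant `Ĉ` and satisfying `c(w, v, v) = 0`,
a continuous linear functional `f` and a viscosity `ν > 0`, if
`γ := Ĉ‖f‖/(α²ν²) < 1` then there exists a unique `u ∈ V` with
`ν a(u,v) + c(u; u, v) = f(v)` for all `v ∈ V`, and it satisfies `‖u‖ ≤ ‖f‖/(α ν)`. -/
theorem statement8 {V : Type*} [NormedAddCommGroup V] [InnerProductSpace ℝ V]
    [CompleteSpace V]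
    (a : V →L[ℝ] V →L[ℝ] ℝ) (α : ℝ) (hα : 0 < α)
    (hcoer : ∀ v : V, α * ‖v‖ ^ 2 ≤ a v v)
    (c : V →ₗ[ℝ] V →ₗ[ℝ] V →ₗ[ℝ] ℝ) (Chat : ℝ)
    (hc : ∀ w u v : V, |c w u v| ≤ Chat * ‖w‖ * ‖u‖ * ‖v‖)
    (hskew : ∀ w v : V, c w v v = 0)
    (f : V →L[ℝ] ℝ) (ν : ℝ) (hν : 0 < ν)
    (hγ : Chat * ‖f‖ / (α ^ 2 * ν ^ 2) < 1) :
    ∃ u : V, (∀ v : V, ν * a u v + c u u v = f v) ∧ ‖u‖ ≤ ‖f‖ / (α * ν) ∧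
      ∀ u' : V, (∀ v : V, ν * a u' v + c u' u' v = f v) → u' = u := by
  obtain ⟨C, hC0, hcC, hγC⟩ : ∃ C : ℝ, 0 ≤ C ∧
      (∀ w u v : V, |c w u v| ≤ C * ‖w‖ * ‖u‖ * ‖v‖) ∧ C * ‖f‖ / (α ^ 2 * ν ^ 2) < 1 := by
    refine ⟨max Chat 0, le_max_right _ _, fun w u v => (hc w u v).trans ?_, ?_⟩
    · gcongr
      exact le_max_left _ _
    · rcases max_choice Chat 0 with h | h
      · rw [h]; exact hγ
      · rw [h]; simp
  have hαν : 0 < α * ν := mul_pos hα hν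
  -- a priori bound for the linearized problem
  have hbound : ∀ w x : V, (∀ v, ν * a x v + c w x v = f v) → ‖x‖ ≤ ‖f‖ / (α * ν) := by
    intro w x hx
    rw [le_div_iff₀ hαν]
    by_cases h0 : ‖x‖ = 0
    · rw [h0]; simp
    have hpos : 0 < ‖x‖ := lt_of_le_of_ne (norm_nonneg _) (Ne.symm h0)
    have h1 := hx x
    rw [hskew, add_zero] at h1
    have h2 : f x ≤ ‖f‖ * ‖x‖ := (le_abs_self _).trans (f.le_opNorm x)
    have h3 := mul_le_mul_of_nonneg_left (hcoer x) hν.le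
    refine le_of_mul_le_mul_right ?_ hpos
    nlinarith
  -- contraction estimate
  have hcontr : ∀ w₁ w₂ x₁ x₂ : V, (∀ v, ν * a x₁ v + c w₁ x₁ v = f v) →
      (∀ v, ν * a x₂ v + c w₂ x₂ v = f v) →
      ‖x₁ - x₂‖ ≤ C * ‖f‖ / (α ^ 2 * ν ^ 2) * ‖w₁ - w₂‖ := by
    intro w₁ w₂ x₁ x₂ h₁ h₂
    by_cases h0 : ‖x₁ - x₂‖ = 0
    · rw [h0]; positivity
    have hpos : 0 < ‖x₁ - x₂‖ := lt_of_le_of_ne (norm_nonneg _) (Ne.symm h0)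
    have e1 : ν * a (x₁ - x₂) (x₁ - x₂) = - c (w₁ - w₂) x₂ (x₁ - x₂) := by
      have e2 := h₁ (x₁ - x₂)
      have e3 := h₂ (x₁ - x₂)
      have e4 : c w₁ x₁ (x₁ - x₂) - c w₁ x₂ (x₁ - x₂) = 0 := by
        have := hskew w₁ (x₁ - x₂)
        rwa [map_sub (c w₁), LinearMap.sub_apply] at this
      have e5 : c (w₁ - w₂) x₂ (x₁ - x₂) = c w₁ x₂ (x₁ - x₂) - c w₂ x₂ (x₁ - x₂) := by
        rw [map_sub c, LinearMap.sub_apply, LinearMap.sub_apply]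
      have e6 : a (x₁ - x₂) (x₁ - x₂) = a x₁ (x₁ - x₂) - a x₂ (x₁ - x₂) := by
        rw [map_sub a, ContinuousLinearMap.sub_apply]
      rw [e5, e6]
      linarith
    have h3 := mul_le_mul_of_nonneg_left (hcoer (x₁ - x₂)) hν.le
    have h4 : - c (w₁ - w₂) x₂ (x₁ - x₂) ≤ C * ‖w₁ - w₂‖ * ‖x₂‖ * ‖x₁ - x₂‖ :=
      (neg_le_abs _).trans (hcC _ _ _)
    have h5 : C * ‖w₁ - w₂‖ * ‖x₂‖ ≤ C * ‖w₁ - w₂‖ * (‖f‖ / (α * ν)) := by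
      have := hbound w₂ x₂ h₂
      gcongr
    have h6 : ‖x₁ - x₂‖ * (α * ν) ≤ C * ‖w₁ - w₂‖ * ‖x₂‖ := by
      refine le_of_mul_le_mul_right ?_ hpos
      nlinarith
    have h7 := (le_div_iff₀ hαν).2 (h6.trans h5)
    refine h7.trans (le_of_eq ?_)
    field_simp
  -- solvability of the linearized problem (Lax-Milgram)
  have hex : ∀ w : V, ∃ x : V, ∀ v, ν * a x v + c w x v = f v := by
    intro w
    let B : V →L[ℝ] V →L[ℝ] ℝ := ν • a + (c w).mkContinuous₂ (C * ‖w‖) (fun x y => by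
      rw [Real.norm_eq_abs]; exact hcC w x y)
    have hB : ∀ x y, B x y = ν * a x y + c w x y := fun x y => by simp [B]
    have hco : IsCoercive B := by
      refine ⟨α * ν, hαν, fun u => ?_⟩
      rw [hB, hskew]
      have h3 := mul_le_mul_of_nonneg_left (hcoer u) hν.le
      nlinarith
    refine ⟨hco.continuousLinearEquivOfBilin.symm ((InnerProductSpace.toDual ℝ V).symm f),
      fun v => ?_⟩
    rw [← hB, ← hco.continuousLinearEquivOfBilin_apply,
      ContinuousLinearEquiv.apply_symm_apply, InnerProductSpace.toDual_symm_apply]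
  choose T hT using hex
  have hγ0 : 0 ≤ C * ‖f‖ / (α ^ 2 * ν ^ 2) := by positivity
  have hTc : ContractingWith ⟨C * ‖f‖ / (α ^ 2 * ν ^ 2), hγ0⟩ T := by
    refine ⟨by exact_mod_cast hγC, LipschitzWith.of_dist_le_mul fun x y => ?_⟩
    rw [dist_eq_norm, dist_eq_norm]
    exact hcontr x y _ _ (hT x) (hT y)
  have hfix : T (hTc.fixedPoint T) = hTc.fixedPoint T := hTc.fixedPoint_isFixedPt
  have hu := hT (hTc.fixedPoint T)
  rw [hfix] at hu
  refine ⟨hTc.fixedPoint T, hu, hbound _ _ hu, fun u' hu' => ?_⟩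
  have h := hcontr _ _ _ _ hu' hu
  rw [← sub_eq_zero, ← norm_eq_zero]
  nlinarith [norm_nonneg (u' - hTc.fixedPoint T)]
end
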